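/- arXiv:2102.07553 — 3 statements merged into one kernel-verified Lean document; each statement's English description precedes it below -/
import Mathlib

section
/- Let A, B ∈ ℍⁿ and t ∈ [0,1]. Then the vector tλ(A) + (1−t)λ(B) majorizes λ(tA + (1−t)B); explicitly, for every k ∈ {1,…,n−1}, ∑_{j=1}^k λ_j(tA + (1−t)B) ≥ ∑_{j=1}^k (t λ_j(A) + (1−t) λ_j(B)), and for k = n equality holds: ∑_{j=1}^n λ_j(tA + (1−t)B) = Tr(tA + (1−t)B) = ∑_{j=1}^n (t λ_j(A) + (1−t) λ_j(B)). -/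
/-- The eigenvalues of a Hermitian matrix, sorted in nondecreasing order
(junk value `0` if the matrix is not Hermitian). -/
noncomputable def sortedEigs {n : ℕ} (A : Matrix (Fin n) (Fin n) ℂ) : Fin n → ℝ :=
  if h : A.IsHermitian then h.eigenvalues ∘ Tuple.sort h.eigenvalues else 0

/-- If `l` is nondecreasing and the weights `p` lie in `[0, 1]` with total mass `k`, the weighted
sum of `l` is at least the sum of its first `k` entries. -/
theorem Monotone.sum_filter_lt_le_sum_mul {n : ℕ} {l p : Fin n → ℝ} (hl : Monotone l) {k : ℕ}
    (hk : 1 ≤ k) (hkn : k ≤ n) (hp0 : ∀ j, 0 ≤ p j) (hp1 : ∀ j, p j ≤ 1)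
    (hp : ∑ j, p j = k) :
    ∑ j ∈ Finset.univ.filter (fun j : Fin n => (j : ℕ) < k), l j ≤ ∑ j, p j * l j := by
  obtain ⟨c, hc⟩ : ∃ c, c = l ⟨k - 1, by omega⟩ := ⟨_, rfl⟩
  have hcard : ∑ j : Fin n, (if (j : ℕ) < k then (1 : ℝ) else 0) = k := by
    rw [Finset.sum_boole, Fin.card_filter_val_lt, min_eq_right hkn]
  have key : 0 ≤ ∑ j : Fin n, (l j - c) * (p j - if (j : ℕ) < k then (1 : ℝ) else 0) := by
    refine Finset.sum_nonneg fun j _ => ?_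
    split_ifs with h
    · have : l j ≤ c := hc ▸ hl (Fin.mk_le_mk.2 (by omega))
      nlinarith [hp1 j]
    · have : c ≤ l j := hc ▸ hl (Fin.mk_le_mk.2 (by omega))
      nlinarith [hp0 j]
  have expand : ∑ j : Fin n, (l j - c) * (p j - if (j : ℕ) < k then (1 : ℝ) else 0)
      = ∑ j, p j * l j - ∑ j : Fin n, (if (j : ℕ) < k then l j else 0)
        - c * (∑ j, p j - ∑ j : Fin n, (if (j : ℕ) < k then (1 : ℝ) else 0)) := by
    rw [← Finset.sum_sub_distrib, ← Finset.sum_sub_distrib, Finset.mul_sum,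
      ← Finset.sum_sub_distrib]
    refine Finset.sum_congr rfl fun j _ => ?_
    split_ifs <;> ring
  rw [expand, hp, hcard] at key
  rw [Finset.sum_filter]
  linarith

theorem sortedEigs_monotone {n : ℕ} (A : Matrix (Fin n) (Fin n) ℂ) : Monotone (sortedEigs A) := by
  unfold sortedEigs
  split_ifs with h
  · exact Tuple.monotone_sort _
  · exact monotone_const

/-- Spectral theorem with the eigenvalues in nondecreasing order. -/
theorem Matrix.IsHermitian.exists_unitary_diagonal_sortedEigs {n : ℕ}
    {A : Matrix (Fin n) (Fin n) ℂ} (hA : A.IsHermitian) :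
    ∃ V : Matrix (Fin n) (Fin n) ℂ, V.conjTranspose * V = 1 ∧
      A = V * Matrix.diagonal (fun j => (sortedEigs A j : ℂ)) * V.conjTranspose := by
  set e := Tuple.sort hA.eigenvalues with he
  set U : Matrix (Fin n) (Fin n) ℂ := hA.eigenvectorUnitary.1
  have hU1 : U.conjTranspose * U = 1 := Unitary.coe_star_mul_self hA.eigenvectorUnitary
  have hd : Matrix.diagonal (fun j => (sortedEigs A j : ℂ))
      = (Matrix.diagonal (fun j => (hA.eigenvalues j : ℂ))).submatrix e e := by
    rw [Matrix.submatrix_diagonal_equiv]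
    simp [sortedEigs, hA, Function.comp_def, he]
  refine ⟨U.submatrix id e, ?_, ?_⟩
  · rw [Matrix.conjTranspose_submatrix, Matrix.submatrix_mul _ _ _ _ _ Function.bijective_id |>.symm,
      hU1, Matrix.submatrix_one_equiv]
  · rw [hd, Matrix.conjTranspose_submatrix, Matrix.submatrix_mul_equiv, Matrix.submatrix_mul_equiv,
      Matrix.submatrix_id_id]
    exact hA.spectral_theorem

/-- The diagonal entries of `Wᴴ D W` for real diagonal `D`. -/
theorem Matrix.re_conjTranspose_mul_diagonal_mul_apply {n : ℕ} (W : Matrix (Fin n) (Fin n) ℂ)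
    (d : Fin n → ℝ) (i : Fin n) :
    ((W.conjTranspose * Matrix.diagonal (fun j => (d j : ℂ)) * W) i i).re
      = ∑ j, Complex.normSq (W j i) * d j := by
  rw [Matrix.mul_apply, Complex.re_sum]
  refine Finset.sum_congr rfl fun j _ => ?_
  rw [Matrix.mul_diagonal, Matrix.conjTranspose_apply]
  simp [Complex.normSq_apply]
  ring

/-- Ky Fan's inequality: the sum of the `k` smallest eigenvalues is at most the sum of the first
`k` diagonal entries in any orthonormal basis. -/
theorem Matrix.IsHermitian.sum_sortedEigs_le {n : ℕ} {A : Matrix (Fin n) (Fin n) ℂ}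
    (hA : A.IsHermitian) {U : Matrix (Fin n) (Fin n) ℂ} (hU : U.conjTranspose * U = 1) {k : ℕ}
    (hk : 1 ≤ k) (hkn : k ≤ n) :
    ∑ j ∈ Finset.univ.filter (fun j : Fin n => (j : ℕ) < k), sortedEigs A j
      ≤ ∑ j ∈ Finset.univ.filter (fun j : Fin n => (j : ℕ) < k),
          ((U.conjTranspose * A * U) j j).re := by
  obtain ⟨V, hV, hAV⟩ := hA.exists_unitary_diagonal_sortedEigs
  obtain ⟨W, hW⟩ : ∃ W, W = V.conjTranspose * U := ⟨_, rfl⟩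
  have hWW : W.conjTranspose * W = 1 := by
    rw [hW, Matrix.conjTranspose_mul, Matrix.conjTranspose_conjTranspose, Matrix.mul_assoc,
      ← Matrix.mul_assoc V, mul_eq_one_comm.1 hV, Matrix.one_mul, hU]
  have hWW' : W * W.conjTranspose = 1 := mul_eq_one_comm.1 hWW
  have hconj : U.conjTranspose * A * U
      = W.conjTranspose * Matrix.diagonal (fun j => (sortedEigs A j : ℂ)) * W := by
    conv_lhs => rw [hAV]
    simp only [hW, Matrix.conjTranspose_mul, Matrix.conjTranspose_conjTranspose, Matrix.mul_assoc]
  have hcol (i : Fin n) : ∑ j, Complex.normSq (W j i) = 1 := by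
    have h := Matrix.re_conjTranspose_mul_diagonal_mul_apply W (fun _ => 1) i
    simpa [hWW] using h.symm
  have hrow (j : Fin n) : ∑ i, Complex.normSq (W j i) = 1 := by
    have h := Matrix.re_conjTranspose_mul_diagonal_mul_apply W.conjTranspose (fun _ => 1) j
    simpa [hWW', Complex.normSq_conj] using h.symm
  simp only [hconj, Matrix.re_conjTranspose_mul_diagonal_mul_apply]
  rw [Finset.sum_comm]
  simp only [← Finset.sum_mul]
  refine (sortedEigs_monotone A).sum_filter_lt_le_sum_mul hk hkn
    (fun j => Finset.sum_nonneg fun i _ => Complex.normSq_nonneg _) (fun j => ?_) ?_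
  · rw [← hrow j]
    exact Finset.sum_le_sum_of_subset_of_nonneg (Finset.filter_subset _ _)
      fun i _ _ => Complex.normSq_nonneg _
  · rw [Finset.sum_comm]
    simp only [hcol]
    rw [Finset.sum_const, Fin.card_filter_val_lt, min_eq_right hkn, nsmul_one]

theorem Matrix.IsHermitian.sum_sortedEigs_eq_re_trace {n : ℕ} {A : Matrix (Fin n) (Fin n) ℂ}
    (hA : A.IsHermitian) : ∑ j, sortedEigs A j = (Matrix.trace A).re := by
  rw [hA.trace_eq_sum_eigenvalues, Complex.re_sum]
  simp only [sortedEigs, hA, dite_true, Function.comp_apply]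
  exact Equiv.sum_comp (Tuple.sort hA.eigenvalues) hA.eigenvalues

/-- For Hermitian `A, B` and `t ∈ [0,1]`, the vector `tλ(A) + (1−t)λ(B)`
majorizes `λ(tA + (1−t)B)` (eigenvalues sorted in nondecreasing order): for every
`k ∈ {1,…,n−1}` the sum of the `k` smallest eigenvalues of `tA + (1−t)B` is at least
`∑_{j=1}^k (tλ_j(A) + (1−t)λ_j(B))`, and for `k = n` both sums equal `Tr(tA + (1−t)B)`. -/
theorem eigenvalues_convex_combination_majorization (n : ℕ)
    (A B : Matrix (Fin n) (Fin n) ℂ) (hA : A.IsHermitian) (hB : B.IsHermitian)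
    (t : ℝ) (ht0 : 0 ≤ t) (ht1 : t ≤ 1) :
    (∀ k : ℕ, 1 ≤ k → k ≤ n - 1 →
      ∑ j ∈ Finset.univ.filter (fun j : Fin n => (j : ℕ) < k),
          (t * sortedEigs A j + (1 - t) * sortedEigs B j)
        ≤ ∑ j ∈ Finset.univ.filter (fun j : Fin n => (j : ℕ) < k),
            sortedEigs ((t : ℂ) • A + ((1 : ℂ) - (t : ℂ)) • B) j) ∧
    (∑ j, sortedEigs ((t : ℂ) • A + ((1 : ℂ) - (t : ℂ)) • B) j
        = (Matrix.trace ((t : ℂ) • A + ((1 : ℂ) - (t : ℂ)) • B)).re) ∧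
    ((Matrix.trace ((t : ℂ) • A + ((1 : ℂ) - (t : ℂ)) • B)).re
        = ∑ j, (t * sortedEigs A j + (1 - t) * sortedEigs B j)) := by
  have hC : ((t : ℂ) • A + ((1 : ℂ) - (t : ℂ)) • B).IsHermitian := by
    simp [Matrix.IsHermitian, Matrix.conjTranspose_add, Matrix.conjTranspose_smul, hA.eq, hB.eq]
  refine ⟨fun k hk hkn => ?_, hC.sum_sortedEigs_eq_re_trace, ?_⟩
  · obtain ⟨U, hU, hCU⟩ := hC.exists_unitary_diagonal_sortedEigs
    have hdiag : U.conjTranspose * ((t : ℂ) • A + ((1 : ℂ) - (t : ℂ)) • B) * U = Matrix.diagonal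
        (fun j => (sortedEigs ((t : ℂ) • A + ((1 : ℂ) - (t : ℂ)) • B) j : ℂ)) := by
      conv_lhs => rw [hCU]
      rw [Matrix.mul_assoc, Matrix.mul_assoc, hU, Matrix.mul_one, ← Matrix.mul_assoc, hU,
        Matrix.one_mul]
    have hentry (j : Fin n) : sortedEigs ((t : ℂ) • A + ((1 : ℂ) - (t : ℂ)) • B) j
        = t * ((U.conjTranspose * A * U) j j).re
          + (1 - t) * ((U.conjTranspose * B * U) j j).re := by
      have h := congrArg Complex.re (congrFun (congrFun hdiag j) j)
      rw [Matrix.diagonal_apply_eq, Complex.ofReal_re] at h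
      rw [← h]
      simp [Matrix.mul_add, Matrix.add_mul]
    simp only [hentry, Finset.sum_add_distrib, ← Finset.mul_sum]
    exact add_le_add
      (mul_le_mul_of_nonneg_left (hA.sum_sortedEigs_le hU hk (by omega)) ht0)
      (mul_le_mul_of_nonneg_left (hB.sum_sortedEigs_le hU hk (by omega)) (sub_nonneg.2 ht1))
  · rw [Finset.sum_add_distrib, ← Finset.mul_sum, ← Finset.mul_sum,
      hA.sum_sortedEigs_eq_re_trace, hB.sum_sortedEigs_eq_re_trace]
    simp
end

section
/- Let Γ ⊂ ℝⁿ be a nonempty open convex set that is symmetric (invariant under permutations of coordinates). Then the set 𝒞 = λ^{-1}(Γ) = {A ∈ ℍⁿ : λ(A) ∈ Γ} is convex: for all A, B ∈ ℍⁿ with λ(A) ∈ Γ and λ(B) ∈ Γ, and all t ∈ [0,1], one has λ(tA + (1−t)B) ∈ Γ. -/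
/-- A symmetric convex set is stable under doubly stochastic matrices. -/
theorem Convex.mulVec_mem_of_doublyStochastic {ι : Type*} [Fintype ι] [DecidableEq ι]
    {Γ : Set (ι → ℝ)} (hconv : Convex ℝ Γ)
    (hsymm : ∀ (σ : Equiv.Perm ι), ∀ x ∈ Γ, x ∘ σ ∈ Γ) {D : Matrix ι ι ℝ}
    (hD : D ∈ doublyStochastic ℝ ι) {x : ι → ℝ} (hx : x ∈ Γ) : D.mulVec x ∈ Γ := by
  obtain ⟨w, hw0, hw1, rfl⟩ := exists_eq_sum_perm_of_mem_doublyStochastic hD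
  simp only [Matrix.sum_mulVec, Matrix.smul_mulVec]
  refine hconv.sum_mem (fun σ _ => hw0 σ) hw1 fun σ _ => ?_
  rw [Matrix.permMatrix_mulVec]
  exact hsymm σ x hx

/-- The squared moduli of the entries of a unitary matrix form a doubly stochastic matrix. -/
theorem Matrix.map_normSq_mem_doublyStochastic {ι : Type*} [Fintype ι] [DecidableEq ι]
    {W : Matrix ι ι ℂ} (hW : W ∈ Matrix.unitaryGroup ι ℂ) :
    W.map Complex.normSq ∈ doublyStochastic ℝ ι := by
  rw [mem_doublyStochastic_iff_sum]
  refine ⟨fun i j => Complex.normSq_nonneg _, fun i => ?_, fun j => ?_⟩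
  · have h := congr_fun₂ (Matrix.mem_unitaryGroup_iff.1 hW) i i
    simp only [Matrix.mul_apply, Matrix.star_apply, Matrix.one_apply_eq, ← starRingEnd_apply,
      Complex.mul_conj] at h
    exact_mod_cast h
  · have h := congr_fun₂ (Matrix.mem_unitaryGroup_iff'.1 hW) j j
    simp only [Matrix.mul_apply, Matrix.star_apply, Matrix.one_apply_eq, ← starRingEnd_apply,
      ← Complex.normSq_eq_conj_mul_self] at h
    exact_mod_cast h

/-- The diagonal of a Hermitian matrix in any orthonormal basis lies in every symmetric convex set
containing its eigenvalues. -/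
theorem Matrix.IsHermitian.diag_conj_mem_of_eigenvalues_mem {ι : Type*} [Fintype ι]
    [DecidableEq ι] {Γ : Set (ι → ℝ)} (hconv : Convex ℝ Γ)
    (hsymm : ∀ (σ : Equiv.Perm ι), ∀ x ∈ Γ, x ∘ σ ∈ Γ) {A : Matrix ι ι ℂ}
    (hA : A.IsHermitian) (hΓ : hA.eigenvalues ∈ Γ) (U : Matrix.unitaryGroup ι ℂ) :
    (fun i => ((star (U : Matrix ι ι ℂ) * A * (U : Matrix ι ι ℂ)) i i).re) ∈ Γ := by
  have hD := Matrix.map_normSq_mem_doublyStochastic (star U * hA.eigenvectorUnitary).2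
  convert hconv.mulVec_mem_of_doublyStochastic hsymm hD hΓ using 1
  set W : Matrix ι ι ℂ := ((star U * hA.eigenvectorUnitary : Matrix.unitaryGroup ι ℂ) :
    Matrix ι ι ℂ) with hW
  have key : star (U : Matrix ι ι ℂ) * A * (U : Matrix ι ι ℂ) =
      W * Matrix.diagonal (RCLike.ofReal ∘ hA.eigenvalues) * star W := by
    conv_lhs => rw [hA.spectral_theorem]
    simp [hW, Unitary.conjStarAlgAut_apply, mul_assoc]
  ext i
  rw [key, Matrix.mul_apply]
  simp only [Matrix.mul_diagonal, Matrix.star_apply, Matrix.mulVec, dotProduct, Matrix.map_apply,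
    Complex.re_sum, Function.comp_apply]
  refine Finset.sum_congr rfl fun j _ => ?_
  simp [Complex.normSq_apply]
  ring

theorem sortedEigs_mem_iff {n : ℕ} {Γ : Set (Fin n → ℝ)}
    (hsymm : ∀ (σ : Equiv.Perm (Fin n)), ∀ x ∈ Γ, x ∘ σ ∈ Γ)
    {A : Matrix (Fin n) (Fin n) ℂ} (hA : A.IsHermitian) :
    sortedEigs A ∈ Γ ↔ hA.eigenvalues ∈ Γ := by
  rw [sortedEigs, dif_pos hA]
  refine ⟨fun h => ?_, hsymm _ _⟩
  simpa [Function.comp_assoc] using hsymm (Tuple.sort hA.eigenvalues)⁻¹ _ h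

/-- Let `Γ ⊂ ℝⁿ` be a nonempty open convex set invariant under
permutations of coordinates. Then `𝒞 = λ⁻¹(Γ)` is convex: for all Hermitian `A, B`
with `λ(A) ∈ Γ` and `λ(B) ∈ Γ`, and all `t ∈ [0,1]`, one has `λ(tA + (1−t)B) ∈ Γ`. -/
theorem eigenvalue_preimage_convex (n : ℕ) (Γ : Set (Fin n → ℝ))
    (hne : Γ.Nonempty) (hopen : IsOpen Γ) (hconv : Convex ℝ Γ)
    (hsymm : ∀ (σ : Equiv.Perm (Fin n)), ∀ x ∈ Γ, x ∘ σ ∈ Γ)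
    (A B : Matrix (Fin n) (Fin n) ℂ) (hA : A.IsHermitian) (hB : B.IsHermitian)
    (hAΓ : sortedEigs A ∈ Γ) (hBΓ : sortedEigs B ∈ Γ)
    (t : ℝ) (ht0 : 0 ≤ t) (ht1 : t ≤ 1) :
    sortedEigs ((t : ℂ) • A + ((1 : ℂ) - (t : ℂ)) • B) ∈ Γ := by
  have hC : ((t : ℂ) • A + ((1 : ℂ) - (t : ℂ)) • B).IsHermitian := by
    simp [Matrix.IsHermitian, Matrix.conjTranspose_add, Matrix.conjTranspose_smul, hA.eq, hB.eq]
  rw [sortedEigs_mem_iff hsymm hC]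
  rw [sortedEigs_mem_iff hsymm hA] at hAΓ
  rw [sortedEigs_mem_iff hsymm hB] at hBΓ
  have hmem := hconv
    (hA.diag_conj_mem_of_eigenvalues_mem hconv hsymm hAΓ hC.eigenvectorUnitary)
    (hB.diag_conj_mem_of_eigenvalues_mem hconv hsymm hBΓ hC.eigenvectorUnitary)
    ht0 (sub_nonneg.2 ht1) (add_sub_cancel t 1)
  convert hmem using 1
  have hdiag := hC.conjStarAlgAut_star_eigenvectorUnitary
  rw [Unitary.conjStarAlgAut_star_apply] at hdiag
  generalize hC.eigenvectorUnitary = U at hdiag ⊢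
  ext i
  have h := congrArg Complex.re (congr_fun₂ hdiag i i)
  rw [Matrix.diagonal_apply_eq] at h
  simp only [mul_add, add_mul, Matrix.mul_smul, Matrix.smul_mul, Matrix.add_apply,
    Matrix.smul_apply, smul_eq_mul, ← Complex.ofReal_one, ← Complex.ofReal_sub, Complex.add_re,
    Complex.re_ofReal_mul] at h
  exact h.symm
end

section
/- Let Γ ⊂ ℝⁿ be a nonempty open convex symmetric set and let Ĝ : Γ → ℝ be concave and symmetric. Then the function A ↦ Ĝ(λ(A)) is concave on 𝒞 = {A ∈ ℍⁿ : λ(A) ∈ Γ}: for all A, B ∈ 𝒞 and t ∈ [0,1], Ĝ(λ(tA + (1−t)B)) ≥ t Ĝ(λ(A)) + (1−t) Ĝ(λ(B)). -/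
open Matrix in
/-- The entrywise squared norm of a unitary matrix is doubly stochastic. -/
theorem normSq_mem_doublyStochastic_of_mem_unitaryGroup {ι : Type*} [Fintype ι] [DecidableEq ι]
    {V : Matrix ι ι ℂ} (hV : V ∈ unitaryGroup ι ℂ) :
    (Matrix.of fun i j => Complex.normSq (V i j)) ∈ doublyStochastic ℝ ι := by
  rw [mem_doublyStochastic_iff_sum]
  refine ⟨fun i j => Complex.normSq_nonneg _, fun i => ?_, fun j => ?_⟩
  · have h := congrFun (congrFun (mem_unitaryGroup_iff.mp hV) i) i
    simp only [star_eq_conjTranspose, mul_apply, conjTranspose_apply, one_apply_eq,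
      RCLike.star_def, Complex.mul_conj] at h
    exact_mod_cast h
  · have h := congrFun (congrFun (mem_unitaryGroup_iff'.mp hV) j) j
    simp only [star_eq_conjTranspose, mul_apply, conjTranspose_apply, one_apply_eq,
      RCLike.star_def, ← Complex.normSq_eq_conj_mul_self] at h
    exact_mod_cast h

open Matrix in
/-- The diagonal of a Hermitian matrix in any orthonormal basis is the image of its vector of
eigenvalues under a doubly stochastic matrix. -/
theorem Matrix.IsHermitian.exists_doublyStochastic_mulVec_eigenvalues_eq_diag
    {ι : Type*} [Fintype ι] [DecidableEq ι] {A : Matrix ι ι ℂ} (hA : A.IsHermitian)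
    (W : unitaryGroup ι ℂ) :
    ∃ D ∈ doublyStochastic ℝ ι, ∀ i,
      (star (W : Matrix ι ι ℂ) * A * (W : Matrix ι ι ℂ)) i i
        = ((D *ᵥ hA.eigenvalues) i : ℝ) := by
  set V : unitaryGroup ι ℂ := star W * hA.eigenvectorUnitary with hV
  refine ⟨_, normSq_mem_doublyStochastic_of_mem_unitaryGroup V.2, fun i => ?_⟩
  have h : star (W : Matrix ι ι ℂ) * A * (W : Matrix ι ι ℂ)
      = (V : Matrix ι ι ℂ) * diagonal (fun j => (hA.eigenvalues j : ℂ))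
        * (V : Matrix ι ι ℂ)ᴴ := by
    conv_lhs => rw [hA.spectral_theorem, Unitary.conjStarAlgAut_apply]
    simp [hV, Matrix.mul_assoc, star_eq_conjTranspose, Function.comp_def]
  rw [h, mul_apply]
  simp only [mul_diagonal, conjTranspose_apply, RCLike.star_def, mulVec, dotProduct, of_apply,
    Complex.ofReal_sum, Complex.ofReal_mul, ← Complex.mul_conj]
  exact Finset.sum_congr rfl fun j _ => by ring

open Matrix in
/-- A symmetric concave function on a convex symmetric set does not decrease when a doubly
stochastic matrix is applied to its argument. -/
theorem ConcaveOn.le_map_doublyStochastic_mulVec {ι : Type*} [Fintype ι] [DecidableEq ι]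
    {Γ : Set (ι → ℝ)} {G : (ι → ℝ) → ℝ} (hG : ConcaveOn ℝ Γ G)
    (hΓsymm : ∀ (σ : Equiv.Perm ι), ∀ x ∈ Γ, x ∘ σ ∈ Γ)
    (hGsymm : ∀ (σ : Equiv.Perm ι), ∀ x ∈ Γ, G (x ∘ σ) = G x)
    {D : Matrix ι ι ℝ} (hD : D ∈ doublyStochastic ℝ ι) {x : ι → ℝ} (hx : x ∈ Γ) :
    D *ᵥ x ∈ Γ ∧ G x ≤ G (D *ᵥ x) := by
  obtain ⟨w, hw0, hw1, rfl⟩ := exists_eq_sum_perm_of_mem_doublyStochastic hD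
  have h : (∑ σ, w σ • σ.permMatrix ℝ) *ᵥ x = ∑ σ, w σ • (x ∘ σ) := by
    simp [sum_mulVec, smul_mulVec, permMatrix_mulVec]
  rw [h]
  refine ⟨hG.1.sum_mem (fun σ _ => hw0 σ) hw1 fun σ _ => hΓsymm σ x hx, ?_⟩
  calc G x = ∑ σ, w σ • G (x ∘ σ) := by
        simp only [hGsymm _ x hx, ← Finset.sum_smul, hw1, one_smul]
    _ ≤ _ := hG.le_map_sum (fun σ _ => hw0 σ) hw1 fun σ _ => hΓsymm σ x hx

theorem sortedEigs_eq_comp {n : ℕ} {A : Matrix (Fin n) (Fin n) ℂ} (hA : A.IsHermitian) :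
    sortedEigs A = hA.eigenvalues ∘ Tuple.sort hA.eigenvalues :=
  dif_pos hA

theorem eigenvalues_eq_sortedEigs_comp {n : ℕ} {A : Matrix (Fin n) (Fin n) ℂ}
    (hA : A.IsHermitian) :
    hA.eigenvalues = sortedEigs A ∘ (Tuple.sort hA.eigenvalues).symm := by
  rw [sortedEigs_eq_comp hA, Function.comp_assoc, Equiv.self_comp_symm, Function.comp_id]

/-- Let `Γ ⊂ ℝⁿ` be a nonempty open convex symmetric set and let
`Ĝ : Γ → ℝ` be concave and symmetric. Then `A ↦ Ĝ(λ(A))` is concave on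
`𝒞 = {A Hermitian : λ(A) ∈ Γ}`: for Hermitian `A, B` with `λ(A), λ(B) ∈ Γ` and
`t ∈ [0,1]`, `Ĝ(λ(tA + (1−t)B)) ≥ t·Ĝ(λ(A)) + (1−t)·Ĝ(λ(B))`. -/
theorem eigenvalue_concave_composition (n : ℕ) (Γ : Set (Fin n → ℝ))
    (hne : Γ.Nonempty) (hopen : IsOpen Γ) (hconv : Convex ℝ Γ)
    (hΓsymm : ∀ (σ : Equiv.Perm (Fin n)), ∀ x ∈ Γ, x ∘ σ ∈ Γ)
    (G : (Fin n → ℝ) → ℝ) (hGconc : ConcaveOn ℝ Γ G)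
    (hGsymm : ∀ (σ : Equiv.Perm (Fin n)), ∀ x ∈ Γ, G (x ∘ σ) = G x)
    (A B : Matrix (Fin n) (Fin n) ℂ) (hA : A.IsHermitian) (hB : B.IsHermitian)
    (hAΓ : sortedEigs A ∈ Γ) (hBΓ : sortedEigs B ∈ Γ)
    (t : ℝ) (ht0 : 0 ≤ t) (ht1 : t ≤ 1) :
    t * G (sortedEigs A) + (1 - t) * G (sortedEigs B)
      ≤ G (sortedEigs ((t : ℂ) • A + ((1 : ℂ) - (t : ℂ)) • B)) := by
  set C := (t : ℂ) • A + ((1 : ℂ) - (t : ℂ)) • B with hCdef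
  have hC : C.IsHermitian := by
    refine .add ?_ ?_ <;> simp [Matrix.IsHermitian, Matrix.conjTranspose_smul, hA.eq, hB.eq]
  have hAe := eigenvalues_eq_sortedEigs_comp hA
  have hBe := eigenvalues_eq_sortedEigs_comp hB
  have hAΓ' : hA.eigenvalues ∈ Γ := hAe ▸ hΓsymm _ _ hAΓ
  have hBΓ' : hB.eigenvalues ∈ Γ := hBe ▸ hΓsymm _ _ hBΓ
  have hGA : G hA.eigenvalues = G (sortedEigs A) := by rw [hAe, hGsymm _ _ hAΓ]
  have hGB : G hB.eigenvalues = G (sortedEigs B) := by rw [hBe, hGsymm _ _ hBΓ]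
  obtain ⟨D, hD, hDA⟩ :=
    hA.exists_doublyStochastic_mulVec_eigenvalues_eq_diag hC.eigenvectorUnitary
  obtain ⟨E, hE, hEB⟩ :=
    hB.exists_doublyStochastic_mulVec_eigenvalues_eq_diag hC.eigenvectorUnitary
  obtain ⟨hDΓ, hDG⟩ := hGconc.le_map_doublyStochastic_mulVec hΓsymm hGsymm hD hAΓ'
  obtain ⟨hEΓ, hEG⟩ := hGconc.le_map_doublyStochastic_mulVec hΓsymm hGsymm hE hBΓ'
  have hCeig : hC.eigenvalues
      = t • D.mulVec hA.eigenvalues + (1 - t) • E.mulVec hB.eigenvalues := by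
    funext i
    have h := congrFun (congrFun hC.conjStarAlgAut_star_eigenvectorUnitary i) i
    rw [Unitary.conjStarAlgAut_star_apply, Matrix.diagonal_apply_eq] at h
    generalize hC.eigenvectorUnitary = W at h hDA hEB
    generalize hC.eigenvalues = μ at h ⊢
    rw [hCdef] at h
    simp only [Matrix.mul_add, Matrix.add_mul, Matrix.mul_smul, Matrix.smul_mul,
      Matrix.add_apply, Matrix.smul_apply, hDA, hEB, smul_eq_mul,
      Function.comp_apply] at h
    simp only [Pi.add_apply, Pi.smul_apply, smul_eq_mul]
    apply Complex.ofReal_injective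
    push_cast
    exact h.symm
  have hCΓ : hC.eigenvalues ∈ Γ :=
    hCeig ▸ hconv hDΓ hEΓ ht0 (sub_nonneg.mpr ht1) (add_sub_cancel t 1)
  rw [sortedEigs_eq_comp hC, hGsymm _ _ hCΓ, ← hGA, ← hGB]
  calc t * G hA.eigenvalues + (1 - t) * G hB.eigenvalues
      ≤ t * G (D.mulVec hA.eigenvalues) + (1 - t) * G (E.mulVec hB.eigenvalues) := by
        have := sub_nonneg.mpr ht1
        gcongr
    _ ≤ G hC.eigenvalues := by
        rw [hCeig]
        exact hGconc.2 hDΓ hEΓ ht0 (sub_nonneg.mpr ht1) (add_sub_cancel t 1)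
end
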